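/- Let ν₁, ν₂, a₁, a₂, b₁, b₂ > 0 and x₁, x₂ > 0, let G and E be probability measures on [0,∞), and let γ(α,β)(t) = β^α t^{α-1} e^{-βt}/Γ(α) denote the Gamma G(α,β) density. Define the model density p(x₁,x₂|θ₁,θ₂) = ∫ γ(ν₁+k,θ₁)(x₁) γ(ν₂+k,θ₂)(x₂) dG(k) and the prior density π(θ₁,θ₂) = ∫ γ(a₁+l,b₁)(θ₁) γ(a₂+l,b₂)(θ₂) dE(l). Define ρ(k,l) = [Γ(a₁+ν₁+k+l) Γ(a₂+ν₂+k+l)/(Γ(a₁+l) Γ(a₂+l) Γ(ν₁+k) Γ(ν₂+k))] · (x₁x₂)^k (b₁b₂)^l / ((b₁+x₁)(b₂+x₂))^{k+l}, and assume 0 < ∫∫ ρ d(G⊗E) < ∞. Then the posterior density π(θ₁,θ₂|x₁,x₂) := π(θ₁,θ₂) p(x₁,x₂|θ₁,θ₂)/∫∫ π p dθ₁ dθ₂ satisfies, for all θ₁, θ₂ > 0: π(θ₁,θ₂|x₁,x₂) = ∫∫ γ(a₁+ν₁+k+l, b₁+x₁)(θ₁) γ(a₂+ν₂+k+l, b₂+x₂)(θ₂)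 · (ρ(k,l)/∫∫ρ d(G⊗E)) d(G⊗E)(k,l). -/

import Mathlib

open MeasureTheory

theorem Real.measurable_Gamma : Measurable Real.Gamma := by
  classical
  set S : Set ℝ := Set.range fun m : ℕ => -(m : ℝ) with hS
  have hSc : S.Countable := Set.countable_range _
  have hcont : ContinuousOn Real.Gamma Sᶜ := fun s hs =>
    (Real.differentiableAt_Gamma fun m h => hs ⟨m, h.symm⟩).continuousAt.continuousWithinAt
  have hpw : Measurable (Sᶜ.piecewise Real.Gamma fun _ => 0) :=
    hcont.measurable_piecewise continuousOn_const hSc.measurableSet.compl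
  refine hpw.measurable_of_countable_ne (hSc.mono fun x hx => ?_)
  by_contra hxS
  exact hx (Set.piecewise_eq_of_mem Sᶜ _ _ hxS)

/-- The density at `t` of the gamma distribution with shape `α` and rate `β`. -/
noncomputable def gammaDensity (α β t : ℝ) : ℝ :=
  β ^ α * t ^ (α - 1) * Real.exp (-(β * t)) / Real.Gamma α

theorem measurable_gammaDensity {X : Type*} [MeasurableSpace X] {α : X → ℝ} (hα : Measurable α)
    (β : ℝ) : Measurable fun z : X × ℝ => gammaDensity (α z.1) β z.2 := by
  have hα' : Measurable fun z : X × ℝ => α z.1 := hα.comp measurable_fst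
  exact (((measurable_const.pow hα').mul (measurable_snd.pow (hα'.sub_const 1))).mul
    (measurable_snd.const_mul β).neg.exp).div (Real.measurable_Gamma.comp hα')

theorem gammaDensity_nonneg {α β t : ℝ} (hα : 0 < α) (hβ : 0 < β) (ht : 0 < t) :
    0 ≤ gammaDensity α β t := by
  have := Real.Gamma_pos_of_pos hα
  unfold gammaDensity
  positivity

theorem setIntegral_gammaDensity {α β : ℝ} (hα : 0 < α) (hβ : 0 < β) :
    ∫ t in Set.Ioi (0 : ℝ), gammaDensity α β t = 1 := by
  have hΓ := Real.Gamma_pos_of_pos hα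
  have hβα : 0 < β ^ α := Real.rpow_pos_of_pos hβ α
  have h : ∀ t, gammaDensity α β t =
      β ^ α / Real.Gamma α * (t ^ (α - 1) * Real.exp (-(β * t))) := fun t => by
    unfold gammaDensity; ring
  simp_rw [h]
  rw [integral_const_mul, Real.integral_rpow_mul_exp_neg_mul_Ioi hα hβ, one_div,
    Real.inv_rpow hβ.le]
  field_simp

/-- Integrating a mixture of products of probability densities on `(0, ∞)` over both variables
leaves the integral of the mixing weight. -/
theorem setIntegral_setIntegral_mixture {X : Type*} [MeasurableSpace X] {μ : Measure X}
    [SFinite μ] {f g : X → ℝ → ℝ} {w : X → ℝ}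
    (hf : Measurable fun z : X × ℝ => f z.1 z.2) (hg : Measurable fun z : X × ℝ => g z.1 z.2)
    (hf0 : ∀ᵐ x ∂μ, ∀ t, 0 < t → 0 ≤ f x t) (hg0 : ∀ᵐ x ∂μ, ∀ t, 0 < t → 0 ≤ g x t)
    (hf1 : ∀ᵐ x ∂μ, ∫ t in Set.Ioi (0 : ℝ), f x t = 1)
    (hg1 : ∀ᵐ x ∂μ, ∫ t in Set.Ioi (0 : ℝ), g x t = 1) (hw : Integrable w μ) :
    ∫ s in Set.Ioi (0 : ℝ), ∫ t in Set.Ioi (0 : ℝ), ∫ x, f x s * g x t * w x ∂μ =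
      ∫ x, w x ∂μ := by
  set v : Measure ℝ := volume.restrict (Set.Ioi 0) with hv
  have hpos : ∀ᵐ t ∂v, (0 : ℝ) < t := ae_restrict_mem measurableSet_Ioi
  have hint : Integrable (fun z : X × ℝ × ℝ => f z.1 z.2.1 * g z.1 z.2.2 * w z.1)
      (μ.prod (v.prod v)) := by
    have hfm : Measurable fun z : X × ℝ × ℝ => f z.1 z.2.1 :=
      hf.comp (measurable_fst.prodMk (measurable_fst.comp measurable_snd))
    have hgm : Measurable fun z : X × ℝ × ℝ => g z.1 z.2.2 :=
      hg.comp (measurable_fst.prodMk (measurable_snd.comp measurable_snd))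
    have hm : AEStronglyMeasurable (fun z : X × ℝ × ℝ => f z.1 z.2.1 * g z.1 z.2.2 * w z.1)
        (μ.prod (v.prod v)) :=
      (hfm.mul hgm).aestronglyMeasurable.mul hw.aestronglyMeasurable.comp_fst
    refine (integrable_prod_iff hm).2 ⟨?_, ?_⟩
    · filter_upwards [hf1, hg1] with x hfx hgx
      have hfi : Integrable (f x) v := .of_integral_ne_zero (by rw [hfx]; exact one_ne_zero)
      have hgi : Integrable (g x) v := .of_integral_ne_zero (by rw [hgx]; exact one_ne_zero)
      exact (hfi.mul_prod hgi).mul_const (w x)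
    · refine hw.norm.congr ?_
      filter_upwards [hf0, hg0, hf1, hg1] with x hfx0 hgx0 hfx hgx
      have hfn : ∫ t, ‖f x t‖ ∂v = 1 := by
        rw [← hfx]
        exact integral_congr_ae (hpos.mono fun t ht => Real.norm_of_nonneg (hfx0 t ht))
      have hgn : ∫ t, ‖g x t‖ ∂v = 1 := by
        rw [← hgx]
        exact integral_congr_ae (hpos.mono fun t ht => Real.norm_of_nonneg (hgx0 t ht))
      simp_rw [norm_mul]
      rw [integral_mul_const, integral_prod_mul (fun t => ‖f x t‖) (fun t => ‖g x t‖), hfn, hgn,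
        one_mul, one_mul]
  calc ∫ s, ∫ t, ∫ x, f x s * g x t * w x ∂μ ∂v ∂v
      = ∫ z : ℝ × ℝ, ∫ x, f x z.1 * g x z.2 * w x ∂μ ∂(v.prod v) :=
        (integral_prod _ hint.integral_prod_right).symm
    _ = ∫ x, ∫ z : ℝ × ℝ, f x z.1 * g x z.2 * w x ∂(v.prod v) ∂μ :=
        (integral_integral_swap hint).symm
    _ = ∫ x, w x ∂μ := by
        refine integral_congr_ae ?_
        filter_upwards [hf1, hg1] with x hfx hgx
        rw [integral_mul_const, integral_prod_mul (f x) (g x), hfx, hgx, one_mul, one_mul]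

/-- Gamma likelihood times gamma prior is proportional to the conjugate gamma posterior. -/
theorem gammaDensity_mul_gammaDensity {ν a b x θ k l : ℝ} (hν : 0 < ν + k) (ha : 0 < a + l)
    (haν : 0 < a + ν + k + l) (hb : 0 < b) (hx : 0 < x) (hθ : 0 < θ) :
    gammaDensity (ν + k) θ x * gammaDensity (a + l) b θ =
      b ^ a * x ^ (ν - 1) / (b + x) ^ (a + ν) *
        (gammaDensity (a + ν + k + l) (b + x) θ *
          (Real.Gamma (a + ν + k + l) / (Real.Gamma (a + l) * Real.Gamma (ν + k)) *
            (x ^ k * b ^ l / (b + x) ^ (k + l)))) := by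
  have hbx : 0 < b + x := add_pos hb hx
  have h₁ := Real.Gamma_pos_of_pos hν
  have h₂ := Real.Gamma_pos_of_pos ha
  have h₃ := Real.Gamma_pos_of_pos haν
  have h₄ : 0 < (b + x) ^ (a + ν) := Real.rpow_pos_of_pos hbx _
  have h₅ : 0 < (b + x) ^ (k + l) := Real.rpow_pos_of_pos hbx _
  have hexp : Real.exp (-((b + x) * θ)) = Real.exp (-(θ * x)) * Real.exp (-(b * θ)) := by
    rw [← Real.exp_add]; ring_nf
  have hpost : (b + x) ^ (a + ν + k + l) = (b + x) ^ (a + ν) * (b + x) ^ (k + l) := by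
    rw [← Real.rpow_add hbx]; ring_nf
  have hθp : θ ^ (a + ν + k + l - 1) = θ ^ (ν + k) * θ ^ (a + l - 1) := by
    rw [← Real.rpow_add hθ]; ring_nf
  have hxp : x ^ (ν + k - 1) = x ^ (ν - 1) * x ^ k := by
    rw [← Real.rpow_add hx]; ring_nf
  have hbp : b ^ (a + l) = b ^ a * b ^ l := Real.rpow_add hb _ _
  unfold gammaDensity
  rw [hexp, hpost, hθp, hxp, hbp]
  field_simp

/-- Corollary 4.2(a): when both the model and the prior are Kibble-type bivariate gamma
mixtures, the posterior is the G2(a₁+ν₁, a₂+ν₂, b₁+x₁, b₂+x₂, ε_x) distribution, ε_x being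
the law of K'+L' where (K',L') has density ρ/∫∫ρ with respect to G ⊗ E. -/
theorem kibble_type_posterior_mixture_prior
    (ν₁ ν₂ a₁ a₂ b₁ b₂ x₁ x₂ : ℝ)
    (hν₁ : 0 < ν₁) (hν₂ : 0 < ν₂) (ha₁ : 0 < a₁) (ha₂ : 0 < a₂)
    (hb₁ : 0 < b₁) (hb₂ : 0 < b₂) (hx₁ : 0 < x₁) (hx₂ : 0 < x₂)
    (G E : Measure ℝ) [IsProbabilityMeasure G] [IsProbabilityMeasure E]
    (hG : G (Set.Iio 0) = 0) (hE : E (Set.Iio 0) = 0)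
    (gam : ℝ → ℝ → ℝ → ℝ)
    (hgam : ∀ α β t, gam α β t = β ^ α * t ^ (α - 1) * Real.exp (-(β * t)) / Real.Gamma α)
    (p : ℝ → ℝ → ℝ)
    (hp : ∀ θ₁ θ₂, p θ₁ θ₂ = ∫ k, gam (ν₁ + k) θ₁ x₁ * gam (ν₂ + k) θ₂ x₂ ∂G)
    (pri : ℝ → ℝ → ℝ)
    (hpri : ∀ θ₁ θ₂, pri θ₁ θ₂ = ∫ l, gam (a₁ + l) b₁ θ₁ * gam (a₂ + l) b₂ θ₂ ∂E)
    (ρ : ℝ → ℝ → ℝ)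
    (hρ : ∀ k l, ρ k l =
      (Real.Gamma (a₁ + ν₁ + k + l) * Real.Gamma (a₂ + ν₂ + k + l) /
        (Real.Gamma (a₁ + l) * Real.Gamma (a₂ + l) *
          Real.Gamma (ν₁ + k) * Real.Gamma (ν₂ + k))) *
      ((x₁ * x₂) ^ k * (b₁ * b₂) ^ l / ((b₁ + x₁) * (b₂ + x₂)) ^ (k + l)))
    (hρint : Integrable (fun q : ℝ × ℝ => ρ q.1 q.2) (G.prod E))
    (hρpos : 0 < ∫ q : ℝ × ℝ, ρ q.1 q.2 ∂(G.prod E)) :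
    ∀ θ₁ θ₂ : ℝ, 0 < θ₁ → 0 < θ₂ →
      pri θ₁ θ₂ * p θ₁ θ₂ /
          (∫ t₁ in Set.Ioi (0 : ℝ), ∫ t₂ in Set.Ioi (0 : ℝ), pri t₁ t₂ * p t₁ t₂) =
        ∫ q : ℝ × ℝ, gam (a₁ + ν₁ + q.1 + q.2) (b₁ + x₁) θ₁ *
            gam (a₂ + ν₂ + q.1 + q.2) (b₂ + x₂) θ₂ *
            (ρ q.1 q.2 / ∫ q' : ℝ × ℝ, ρ q'.1 q'.2 ∂(G.prod E)) ∂(G.prod E) := by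
  obtain rfl : gam = gammaDensity := by
    funext α β t
    exact hgam α β t
  have hk : ∀ᵐ q ∂G.prod E, 0 ≤ q.1 := by
    have h : ∀ᵐ k ∂G, 0 ≤ k := by
      rw [ae_iff]; simp only [not_le]; exact hG
    exact Measure.quasiMeasurePreserving_fst.ae h
  have hl : ∀ᵐ q ∂G.prod E, 0 ≤ q.2 := by
    have h : ∀ᵐ l ∂E, 0 ≤ l := by
      rw [ae_iff]; simp only [not_le]; exact hE
    exact Measure.quasiMeasurePreserving_snd.ae h
  have hbx₁ : 0 < b₁ + x₁ := add_pos hb₁ hx₁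
  have hbx₂ : 0 < b₂ + x₂ := add_pos hb₂ hx₂
  set C : ℝ := b₁ ^ a₁ * x₁ ^ (ν₁ - 1) / (b₁ + x₁) ^ (a₁ + ν₁) *
    (b₂ ^ a₂ * x₂ ^ (ν₂ - 1) / (b₂ + x₂) ^ (a₂ + ν₂)) with hC
  have hCpos : 0 < C := by positivity
  have hjoint : ∀ θ₁ θ₂ : ℝ, 0 < θ₁ → 0 < θ₂ → pri θ₁ θ₂ * p θ₁ θ₂ =
      C * ∫ q : ℝ × ℝ, gammaDensity (a₁ + ν₁ + q.1 + q.2) (b₁ + x₁) θ₁ *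
        gammaDensity (a₂ + ν₂ + q.1 + q.2) (b₂ + x₂) θ₂ * ρ q.1 q.2 ∂(G.prod E) := by
    intro θ₁ θ₂ hθ₁ hθ₂
    rw [mul_comm (pri θ₁ θ₂), hp, hpri, ← integral_prod_mul, ← integral_const_mul]
    refine integral_congr_ae ?_
    filter_upwards [hk, hl] with q hq₁ hq₂
    have e₁ := gammaDensity_mul_gammaDensity (ν := ν₁) (a := a₁) (k := q.1) (l := q.2)
      (by positivity) (by positivity) (by positivity) hb₁ hx₁ hθ₁
    have e₂ := gammaDensity_mul_gammaDensity (ν := ν₂) (a := a₂) (k := q.1) (l := q.2)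
      (by positivity) (by positivity) (by positivity) hb₂ hx₂ hθ₂
    rw [mul_mul_mul_comm, e₁, e₂, hρ, Real.mul_rpow hx₁.le hx₂.le, Real.mul_rpow hb₁.le hb₂.le,
      Real.mul_rpow hbx₁.le hbx₂.le, hC]
    ring
  have hmarg : ∫ t₁ in Set.Ioi (0 : ℝ), ∫ t₂ in Set.Ioi (0 : ℝ), pri t₁ t₂ * p t₁ t₂ =
      C * ∫ q : ℝ × ℝ, ρ q.1 q.2 ∂(G.prod E) := by
    have hshape : ∀ c : ℝ, Measurable fun q : ℝ × ℝ => c + q.1 + q.2 := fun c => by fun_prop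
    have hden : ∀ {c β : ℝ}, 0 < c → 0 < β → ∀ᵐ q : ℝ × ℝ ∂G.prod E, ∀ t, 0 < t →
        0 ≤ gammaDensity (c + q.1 + q.2) β t := fun hc hβ => by
      filter_upwards [hk, hl] with q hq₁ hq₂ t ht
      exact gammaDensity_nonneg (by positivity) hβ ht
    have hone : ∀ {c β : ℝ}, 0 < c → 0 < β → ∀ᵐ q : ℝ × ℝ ∂G.prod E,
        ∫ t in Set.Ioi (0 : ℝ), gammaDensity (c + q.1 + q.2) β t = 1 := fun hc hβ => by
      filter_upwards [hk, hl] with q hq₁ hq₂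
      exact setIntegral_gammaDensity (by positivity) hβ
    rw [← setIntegral_setIntegral_mixture
      (measurable_gammaDensity (hshape (a₁ + ν₁)) (b₁ + x₁))
      (measurable_gammaDensity (hshape (a₂ + ν₂)) (b₂ + x₂))
      (hden (add_pos ha₁ hν₁) hbx₁) (hden (add_pos ha₂ hν₂) hbx₂)
      (hone (add_pos ha₁ hν₁) hbx₁) (hone (add_pos ha₂ hν₂) hbx₂) hρint, ← integral_const_mul]
    refine setIntegral_congr_fun measurableSet_Ioi fun t₁ ht₁ => ?_
    rw [← integral_const_mul]
    exact setIntegral_congr_fun measurableSet_Ioi fun t₂ ht₂ => hjoint t₁ t₂ ht₁ ht₂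
  intro θ₁ θ₂ hθ₁ hθ₂
  rw [hjoint θ₁ θ₂ hθ₁ hθ₂, hmarg, mul_div_mul_left _ _ hCpos.ne', ← integral_div]
  simp only [mul_div_assoc]
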